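/- Let q be a real number with 0 < q < 1 and let c be an arbitrary real number. Then ∑_{i,j,k ≥ 0} q^{2i²+2j²+2k²−2ik−2jk−ci+cj} / ((q⁴;q⁴)_i (q⁴;q⁴)_j (q⁴;q⁴)_k) = J̄_{2+c,4} J̄_{6+c,12} / J_4² + q² J̄_{−c,4} J̄_{c,12} / J_4². -/

import Mathlib

open scoped BigOperators Topology Real

/-- Finite q-Pochhammer symbol `(a;q)_n = ∏_{k=0}^{n-1} (1 - a q^k)`. -/
noncomputable def qPochFinR (a q : ℝ) (n : ℕ) : ℝ := ∏ k ∈ Finset.range n, (1 - a * q ^ k)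

/-- Infinite q-Pochhammer symbol `(a;q)_∞ = ∏_{k=0}^{∞} (1 - a q^k)`. -/
noncomputable def qPochInfR (a q : ℝ) : ℝ := ∏' k : ℕ, (1 - a * q ^ k)

/-- `J_m = (q^m; q^m)_∞` with `q^m` the real power of `q`. -/
noncomputable def JR (q m : ℝ) : ℝ := qPochInfR (q ^ m) (q ^ m)

/-- `J_{a,m} = (q^a;q^m)_∞ (q^{m-a};q^m)_∞ (q^m;q^m)_∞` with real powers of `q`. -/
noncomputable def JamR (q a m : ℝ) : ℝ :=
  qPochInfR (q ^ a) (q ^ m) * qPochInfR (q ^ (m - a)) (q ^ m) * qPochInfR (q ^ m) (q ^ m)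

/-- `J̄_{a,m} = (-q^a;q^m)_∞ (-q^{m-a};q^m)_∞ (q^m;q^m)_∞` with real powers of `q`. -/
noncomputable def JbarR (q a m : ℝ) : ℝ :=
  qPochInfR (-(q ^ a)) (q ^ m) * qPochInfR (-(q ^ (m - a))) (q ^ m) * qPochInfR (q ^ m) (q ^ m)

open Filter Finset ENNReal

lemma qPochFinR_succ (a p : ℝ) (n : ℕ) :
    qPochFinR a p (n + 1) = qPochFinR a p n * (1 - a * p ^ n) := by
  simp [qPochFinR, prod_range_succ]

lemma one_sub_pow_succ_pos {p : ℝ} (hp0 : 0 < p) (hp1 : p < 1) (n : ℕ) : 0 < 1 - p ^ (n + 1) :=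
  sub_pos.2 (pow_lt_one₀ hp0.le hp1 n.succ_ne_zero)

lemma qPochFinR_self_pos {p : ℝ} (hp0 : 0 < p) (hp1 : p < 1) (n : ℕ) : 0 < qPochFinR p p n := by
  refine prod_pos fun k _ ↦ ?_
  rw [← pow_succ']
  exact one_sub_pow_succ_pos hp0 hp1 k

lemma summable_qPoch_factor (a : ℝ) {p : ℝ} (hp0 : 0 < p) (hp1 : p < 1) :
    Summable fun k : ℕ ↦ ‖-(a * p ^ k)‖ := by
  simp only [norm_neg, norm_mul, norm_pow, Real.norm_of_nonneg hp0.le]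
  exact (summable_geometric_of_lt_one hp0.le hp1).mul_left _

lemma tendsto_qPochFinR (a : ℝ) {p : ℝ} (hp0 : 0 < p) (hp1 : p < 1) :
    Tendsto (qPochFinR a p) atTop (𝓝 (qPochInfR a p)) := by
  have h := multipliable_one_add_of_summable (summable_qPoch_factor a hp0 hp1)
  simp only [← sub_eq_add_neg] at h
  exact h.tendsto_prod_tprod_nat

lemma qPochFinR_self_antitone {p : ℝ} (hp0 : 0 < p) (hp1 : p < 1) :
    Antitone (qPochFinR p p) := by
  refine antitone_nat_of_succ_le fun n ↦ ?_
  rw [qPochFinR_succ]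
  exact mul_le_of_le_one_right (qPochFinR_self_pos hp0 hp1 n).le (by simp; positivity)

lemma qPochInfR_self_pos {p : ℝ} (hp0 : 0 < p) (hp1 : p < 1) : 0 < qPochInfR p p := by
  have hnn : 0 ≤ qPochInfR p p :=
    ge_of_tendsto' (tendsto_qPochFinR p hp0 hp1) fun n ↦ (qPochFinR_self_pos hp0 hp1 n).le
  refine hnn.lt_of_ne' ?_
  have h := tprod_one_add_ne_zero_of_summable (f := fun k : ℕ ↦ -(p * p ^ k)) (fun k ↦ ?_)
    (summable_qPoch_factor p hp0 hp1)
  · simpa [qPochInfR, sub_eq_add_neg] using h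
  · rw [← pow_succ', ← sub_eq_add_neg]
    exact (one_sub_pow_succ_pos hp0 hp1 k).ne'

lemma qPochInfR_le_qPochFinR {p : ℝ} (hp0 : 0 < p) (hp1 : p < 1) (n : ℕ) :
    qPochInfR p p ≤ qPochFinR p p n :=
  (qPochFinR_self_antitone hp0 hp1).le_of_tendsto (tendsto_qPochFinR p hp0 hp1) n

lemma qPochInfR_neg_nonneg {p z : ℝ} (hp0 : 0 < p) (hp1 : p < 1) (hz : 0 < z) :
    0 ≤ qPochInfR (-z) p :=
  ge_of_tendsto' (tendsto_qPochFinR _ hp0 hp1) fun _ ↦ prod_nonneg fun k _ ↦ by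
    rw [neg_mul, sub_neg_eq_add]; positivity

/-- The coefficient `p^{n(n-1)/2} / (p;p)_n` of Euler's expansion of `(-z;p)_∞`. -/
noncomputable def eulerCoeff (p : ℝ) (n : ℕ) : ℝ := p ^ n.choose 2 / qPochFinR p p n

lemma eulerCoeff_zero (p : ℝ) : eulerCoeff p 0 = 1 := by simp [eulerCoeff, qPochFinR]

lemma eulerCoeff_pos {p : ℝ} (hp0 : 0 < p) (hp1 : p < 1) (n : ℕ) : 0 < eulerCoeff p n :=
  div_pos (by positivity) (qPochFinR_self_pos hp0 hp1 n)

lemma eulerCoeff_succ {p : ℝ} (hp0 : 0 < p) (hp1 : p < 1) (n : ℕ) :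
    eulerCoeff p (n + 1) * (1 - p ^ (n + 1)) = p ^ n * eulerCoeff p n := by
  have h0 := (qPochFinR_self_pos hp0 hp1 n).ne'
  have h1 := (qPochFinR_self_pos hp0 hp1 (n + 1)).ne'
  have h2 : 1 - p ^ (n + 1) ≠ 0 := (one_sub_pow_succ_pos hp0 hp1 n).ne'
  rw [eulerCoeff, eulerCoeff, Nat.choose_succ_succ' n 1, qPochFinR_succ, ← pow_succ', pow_add,
    Nat.choose_one_right]
  field_simp

lemma summable_eulerCoeff {p z : ℝ} (hp0 : 0 < p) (hp1 : p < 1) (hz : 0 < z) :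
    Summable fun n ↦ eulerCoeff p n * z ^ n := by
  refine summable_of_ratio_test_tendsto_lt_one (l := 0) zero_lt_one
    (.of_forall fun n ↦ (mul_pos (eulerCoeff_pos hp0 hp1 n) (by positivity)).ne') ?_
  have hp := tendsto_pow_atTop_nhds_zero_of_lt_one hp0.le hp1
  have h : Tendsto (fun n : ℕ ↦ p ^ n * z / (1 - p ^ (n + 1))) atTop (𝓝 (0 * z / (1 - 0))) :=
    (hp.mul_const z).div (tendsto_const_nhds.sub ((tendsto_add_atTop_iff_nat 1).2 hp)) (by simp)
  simp only [zero_mul, zero_div] at h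
  refine h.congr fun n ↦ ?_
  have h2 : 1 - p ^ (n + 1) ≠ 0 := (one_sub_pow_succ_pos hp0 hp1 n).ne'
  have h3 := eulerCoeff_pos hp0 hp1 n
  have h4 := eulerCoeff_pos hp0 hp1 (n + 1)
  rw [Real.norm_of_nonneg (by positivity), Real.norm_of_nonneg (by positivity),
    div_eq_div_iff h2 (by positivity)]
  linear_combination -z ^ (n + 1) * eulerCoeff_succ hp0 hp1 n

lemma tsum_eulerCoeff_step {p z : ℝ} (hp0 : 0 < p) (hp1 : p < 1) (hz : 0 < z) :
    ∑' n, eulerCoeff p n * z ^ n = (1 + z) * ∑' n, eulerCoeff p n * (z * p) ^ n := by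
  have h1 := summable_eulerCoeff hp0 hp1 hz
  have h2 := summable_eulerCoeff hp0 hp1 (mul_pos hz hp0)
  have h3 : ∑' n, (eulerCoeff p n * z ^ n - eulerCoeff p n * (z * p) ^ n) =
      z * ∑' n, eulerCoeff p n * (z * p) ^ n := by
    rw [(h1.sub h2).tsum_eq_zero_add, ← tsum_mul_left]
    simp only [pow_zero, sub_self, zero_add]
    refine tsum_congr fun n ↦ ?_
    rw [mul_pow, mul_pow]
    linear_combination z ^ (n + 1) * eulerCoeff_succ hp0 hp1 n
  rw [h1.tsum_sub h2] at h3
  linear_combination h3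

lemma tsum_eulerCoeff_iterate {p z : ℝ} (hp0 : 0 < p) (hp1 : p < 1) (hz : 0 < z) (k : ℕ) :
    ∑' n, eulerCoeff p n * z ^ n =
      qPochFinR (-z) p k * ∑' n, eulerCoeff p n * (z * p ^ k) ^ n := by
  induction k with
  | zero => simp [qPochFinR]
  | succ k ih =>
    rw [ih, tsum_eulerCoeff_step hp0 hp1 (by positivity), qPochFinR_succ, pow_succ]
    ring_nf

/-- Euler's expansion of the infinite product `(-z;p)_∞`. -/
lemma tsum_eulerCoeff {p z : ℝ} (hp0 : 0 < p) (hp1 : p < 1) (hz : 0 < z) :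
    ∑' n, eulerCoeff p n * z ^ n = qPochInfR (-z) p := by
  have hlim : Tendsto (fun k : ℕ ↦ ∑' n, eulerCoeff p n * (z * p ^ k) ^ n) atTop
      (𝓝 (∑' n, if n = 0 then 1 else 0)) := by
    refine tendsto_tsum_of_dominated_convergence (summable_eulerCoeff hp0 hp1 hz) (fun n ↦ ?_)
      (.of_forall fun k n ↦ ?_)
    · rcases n with _ | n
      · simp [eulerCoeff_zero]
      · have hp := tendsto_pow_atTop_nhds_zero_of_lt_one hp0.le hp1
        simpa using ((hp.const_mul z).pow (n + 1)).const_mul (eulerCoeff p (n + 1))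
    · have := eulerCoeff_pos hp0 hp1 n
      rw [Real.norm_of_nonneg (by positivity)]
      gcongr
      exact mul_le_of_le_one_right hz.le (pow_le_one₀ hp0.le hp1.le)
  have h := (tendsto_qPochFinR (-z) hp0 hp1).mul hlim
  rw [tsum_ite_eq, mul_one] at h
  exact tendsto_nhds_unique
    (tendsto_const_nhds.congr (tsum_eulerCoeff_iterate hp0 hp1 hz)) h

/-- The finite `q`-binomial theorem. -/
lemma qPochFinR_div_eq_sum_antidiagonal {p : ℝ} (hp0 : 0 < p) (hp1 : p < 1) (z : ℝ) (k : ℕ) :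
    qPochFinR (-z) p k / qPochFinR p p k =
      ∑ x ∈ antidiagonal k, eulerCoeff p x.1 * z ^ x.1 / qPochFinR p p x.2 := by
  induction k with
  | zero => simp [qPochFinR, eulerCoeff]
  | succ k ih =>
    have hne (n : ℕ) : 1 - p ^ (n + 1) ≠ 0 := (one_sub_pow_succ_pos hp0 hp1 n).ne'
    have hP (n : ℕ) := (qPochFinR_self_pos hp0 hp1 n).ne'
    have h1 : ∑ x ∈ antidiagonal (k + 1),
        eulerCoeff p x.1 * z ^ x.1 / qPochFinR p p x.2 * (1 - p ^ x.2) =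
        qPochFinR (-z) p k / qPochFinR p p k := by
      rw [Nat.sum_antidiagonal_succ', ih]
      simp only [pow_zero, sub_self, mul_zero, zero_add]
      refine sum_congr rfl fun x _ ↦ ?_
      rw [qPochFinR_succ, ← pow_succ']
      have := hne x.2
      have := hP x.2
      field_simp
    have h2 : ∑ x ∈ antidiagonal (k + 1),
        eulerCoeff p x.1 * z ^ x.1 / qPochFinR p p x.2 * (p ^ x.2 * (1 - p ^ x.1)) =
        z * p ^ k * (qPochFinR (-z) p k / qPochFinR p p k) := by
      rw [Nat.sum_antidiagonal_succ, ih, mul_sum]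
      simp only [pow_zero, sub_self, mul_zero, zero_add]
      refine sum_congr rfl fun x hx ↦ ?_
      rw [← mem_antidiagonal.1 hx, pow_add]
      linear_combination z ^ (x.1 + 1) * p ^ x.2 / qPochFinR p p x.2 *
        eulerCoeff_succ hp0 hp1 x.1
    have h3 : (∑ x ∈ antidiagonal (k + 1),
        eulerCoeff p x.1 * z ^ x.1 / qPochFinR p p x.2) * (1 - p ^ (k + 1)) =
        (1 + z * p ^ k) * (qPochFinR (-z) p k / qPochFinR p p k) := by
      rw [add_mul, one_mul, ← h2, ← h1, ← sum_add_distrib, sum_mul]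
      refine sum_congr rfl fun x hx ↦ ?_
      rw [← mem_antidiagonal.1 hx, pow_add]
      ring
    refine mul_right_cancel₀ (hne k) ?_
    rw [h3, qPochFinR_succ, qPochFinR_succ, ← pow_succ']
    have := hne k
    have := hP k
    field_simp
    ring

lemma summable_durfee {p : ℝ} (hp0 : 0 < p) (hp1 : p < 1) (d : ℕ) :
    Summable fun r : ℕ ↦ p ^ (r * (r + d)) / (qPochFinR p p r * qPochFinR p p (r + d)) := by
  have hW := qPochInfR_self_pos hp0 hp1
  refine .of_nonneg_of_le (fun r ↦ ?_) (fun r ↦ ?_)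
    ((summable_geometric_of_lt_one hp0.le hp1).div_const (qPochInfR p p * qPochInfR p p))
  · have := qPochFinR_self_pos hp0 hp1 r
    have := qPochFinR_self_pos hp0 hp1 (r + d)
    positivity
  · have := qPochInfR_le_qPochFinR hp0 hp1 r
    have := qPochInfR_le_qPochFinR hp0 hp1 (r + d)
    have := qPochFinR_self_pos hp0 hp1 r
    have h : p ^ (r * (r + d)) ≤ p ^ r := by
      refine pow_le_pow_of_le_one hp0.le hp1.le ?_
      rcases r with _ | r
      · simp
      · exact Nat.le_mul_of_pos_right _ (by omega)
    gcongr

lemma durfee_recurrence {p : ℝ} (hp0 : 0 < p) (hp1 : p < 1) {D : ℕ → ℝ}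
    (hD : ∀ d, D d = ∑' r : ℕ, p ^ (r * (r + d)) / (qPochFinR p p r * qPochFinR p p (r + d)))
    (d : ℕ) : D d - D (d + 1) = -p ^ (d + 1) * (D (d + 1) - D (d + 2)) := by
  have hs := summable_durfee hp0 hp1
  have hne (n : ℕ) : 1 - p ^ (n + 1) ≠ 0 := (one_sub_pow_succ_pos hp0 hp1 n).ne'
  have hP (n : ℕ) := (qPochFinR_self_pos hp0 hp1 n).ne'
  have key (r : ℕ) : p ^ (r * (r + d)) / (qPochFinR p p r * qPochFinR p p (r + d)) -
      p ^ (r * (r + (d + 1))) / (qPochFinR p p r * qPochFinR p p (r + (d + 1))) +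
      p ^ (d + 1) * (p ^ (r * (r + (d + 1))) /
        (qPochFinR p p r * qPochFinR p p (r + (d + 1)))) =
      p ^ (r * (r + d)) * (1 - p ^ r) / (qPochFinR p p r * qPochFinR p p (r + (d + 1))) := by
    rw [← add_assoc, qPochFinR_succ, ← pow_succ']
    have := hne (r + d)
    have := hP r
    have := hP (r + d)
    field_simp
    ring
  have hsum := ((hs d).sub (hs (d + 1))).add ((hs (d + 1)).mul_left (p ^ (d + 1)))
  have h : D d - D (d + 1) + p ^ (d + 1) * D (d + 1) = p ^ (d + 1) * D (d + 2) := by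
    rw [hD d, hD (d + 1), hD (d + 2), ← tsum_mul_left, ← (hs d).tsum_sub (hs (d + 1)),
      ← ((hs d).sub (hs (d + 1))).tsum_add ((hs (d + 1)).mul_left _), hsum.tsum_eq_zero_add,
      ← tsum_mul_left, key 0]
    simp only [pow_zero, sub_self, mul_zero, zero_div, zero_add]
    refine tsum_congr fun r ↦ ?_
    rw [key, qPochFinR_succ, ← pow_succ', show r + 1 + (d + 1) = r + (d + 2) by ring]
    have := hne r
    have := hP r
    have := hP (r + (d + 2))
    field_simp
    ring
  linear_combination h

/-- The limiting case of the `q`-Vandermonde summation behind Durfee rectangles. -/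
lemma tsum_durfee {p : ℝ} (hp0 : 0 < p) (hp1 : p < 1) (d : ℕ) :
    ∑' r : ℕ, p ^ (r * (r + d)) / (qPochFinR p p r * qPochFinR p p (r + d)) =
      1 / qPochInfR p p := by
  set D : ℕ → ℝ := fun d ↦
    ∑' r : ℕ, p ^ (r * (r + d)) / (qPochFinR p p r * qPochFinR p p (r + d))
  have hW := qPochInfR_self_pos hp0 hp1
  have hlim : Tendsto D atTop (𝓝 (∑' r : ℕ, if r = 0 then 1 / qPochInfR p p else 0)) := by
    refine tendsto_tsum_of_dominated_convergence
      ((summable_geometric_of_lt_one hp0.le hp1).div_const (qPochInfR p p * qPochInfR p p))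
      (fun r ↦ ?_) (.of_forall fun d r ↦ ?_)
    · have ht := tendsto_qPochFinR p hp0 hp1
      rcases r with _ | r
      · simpa [qPochFinR] using ht.inv₀ hW.ne'
      · have hr := qPochFinR_self_pos hp0 hp1 (r + 1)
        have h1 : Tendsto (fun d ↦ qPochFinR p p (r + 1 + d)) atTop (𝓝 (qPochInfR p p)) := by
          simpa only [add_comm] using (tendsto_add_atTop_iff_nat (r + 1)).2 ht
        have h2 : Tendsto (fun d ↦ p ^ ((r + 1) * (r + 1 + d))) atTop (𝓝 0) := by
          refine (tendsto_pow_atTop_nhds_zero_of_lt_one hp0.le hp1).comp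
            (tendsto_atTop_mono (fun d ↦ ?_) tendsto_id)
          simp only [id]
          nlinarith
        simpa only [zero_div, Pi.div_def, if_neg r.succ_ne_zero] using
          h2.div (h1.const_mul (qPochFinR p p (r + 1))) (by positivity)
    · have := qPochInfR_le_qPochFinR hp0 hp1 r
      have := qPochInfR_le_qPochFinR hp0 hp1 (r + d)
      have := qPochFinR_self_pos hp0 hp1 r
      have := qPochFinR_self_pos hp0 hp1 (r + d)
      rw [Real.norm_of_nonneg (by positivity)]
      have h : p ^ (r * (r + d)) ≤ p ^ r := by
        refine pow_le_pow_of_le_one hp0.le hp1.le ?_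
        rcases r with _ | r
        · simp
        · exact Nat.le_mul_of_pos_right _ (by omega)
      gcongr
  rw [tsum_ite_eq] at hlim
  have hrec := durfee_recurrence hp0 hp1 (D := D) (fun _ ↦ rfl)
  have habs (d n : ℕ) : |D d - D (d + 1)| ≤ |D (d + n) - D (d + n + 1)| := by
    induction n with
    | zero => rfl
    | succ n ih =>
      refine ih.trans ?_
      rw [hrec (d + n), abs_mul, abs_neg, abs_of_pos (by positivity)]
      exact mul_le_of_le_one_left (abs_nonneg _) (pow_le_one₀ hp0.le hp1.le)
  have hstep (d : ℕ) : D (d + 1) = D d := by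
    have h1 : Tendsto (fun n ↦ |D (d + n) - D (d + n + 1)|) atTop (𝓝 0) := by
      have ha : Tendsto (fun n ↦ D (d + n)) atTop (𝓝 (1 / qPochInfR p p)) := by
        simpa only [add_comm] using (tendsto_add_atTop_iff_nat d).2 hlim
      simpa [add_assoc] using (ha.sub ((tendsto_add_atTop_iff_nat 1).2 ha)).abs
    have h2 := ge_of_tendsto' h1 (habs d)
    linarith [abs_nonpos_iff.1 h2]
  have hconst (n : ℕ) : D (n + d) = D d := by
    induction n with
    | zero => simp
    | succ n ih => rw [← ih, ← hstep (n + d), Nat.add_right_comm]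
  exact tendsto_nhds_unique
    (tendsto_const_nhds.congr fun n ↦ (hconst n).symm) ((tendsto_add_atTop_iff_nat d).2 hlim)

/-- Splitting a pair of naturals into its difference and its minimum. -/
def natProdEquivIntProdNat : ℕ × ℕ ≃ ℤ × ℕ where
  toFun x := ((x.1 : ℤ) - x.2, min x.1 x.2)
  invFun y := (y.2 + y.1.toNat, y.2 + (-y.1).toNat)
  left_inv x := by ext <;> simp only <;> omega
  right_inv y := by ext <;> simp only <;> omega

lemma tsum_nat_nat_eq_tsum_int_nat (f : ℕ → ℕ → ℝ≥0∞) :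
    ∑' (i : ℕ) (j : ℕ), f i j =
      ∑' (n : ℤ) (r : ℕ), f (r + n.toNat) (r + (-n).toNat) := by
  rw [← ENNReal.tsum_prod, ← ENNReal.tsum_prod, ← natProdEquivIntProdNat.symm.tsum_eq]
  rfl

/-- A double sum weighted by `p^{ij} / ((p;p)_i (p;p)_j)` only sees the difference `i - j`. -/
lemma tsum_tsum_pow_mul_div_qPochFinR {p : ℝ} (hp0 : 0 < p) (hp1 : p < 1) (g : ℤ → ℝ≥0∞) :
    ∑' (i : ℕ) (j : ℕ), ENNReal.ofReal (p ^ (i * j) / (qPochFinR p p i * qPochFinR p p j)) *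
      g (i - j) = ENNReal.ofReal (1 / qPochInfR p p) * ∑' n, g n := by
  rw [tsum_nat_nat_eq_tsum_int_nat, ← ENNReal.tsum_mul_left]
  refine tsum_congr fun n ↦ ?_
  have hpos (r d : ℕ) :
      0 ≤ p ^ (r * (r + d)) / (qPochFinR p p r * qPochFinR p p (r + d)) := by
    have := qPochFinR_self_pos hp0 hp1 r
    have := qPochFinR_self_pos hp0 hp1 (r + d)
    positivity
  rw [← tsum_durfee hp0 hp1 n.natAbs,
    ENNReal.ofReal_tsum_of_nonneg (hpos · _) (summable_durfee hp0 hp1 _), ← ENNReal.tsum_mul_right]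
  refine tsum_congr fun r ↦ ?_
  congr 2
  · obtain ⟨d, rfl | rfl⟩ := n.eq_nat_or_neg
    · simp [mul_comm]
    · simp
  · push_cast
    omega

lemma ofReal_qPochInfR_neg {p z : ℝ} (hp0 : 0 < p) (hp1 : p < 1) (hz : 0 < z) :
    ENNReal.ofReal (qPochInfR (-z) p) = ∑' n, ENNReal.ofReal (eulerCoeff p n * z ^ n) := by
  rw [← tsum_eulerCoeff hp0 hp1 hz]
  refine ENNReal.ofReal_tsum_of_nonneg (fun n ↦ ?_) (summable_eulerCoeff hp0 hp1 hz)
  have := eulerCoeff_pos hp0 hp1 n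
  positivity

lemma tsum_sum_antidiagonal (g : ℕ → ℕ → ℝ≥0∞) :
    ∑' k, ∑ x ∈ antidiagonal k, g x.1 x.2 = ∑' (a : ℕ) (r : ℕ), g a r := by
  rw [← ENNReal.tsum_prod, ← HasAntidiagonal.sigmaAntidiagonalEquivProd.tsum_eq, ENNReal.tsum_sigma']
  refine tsum_congr fun k ↦ ?_
  rw [tsum_fintype, ← Finset.sum_coe_sort]
  rfl

lemma eulerCoeff_rpow_mul {q : ℝ} (hq0 : 0 < q) (m y : ℝ) (n : ℕ) :
    eulerCoeff (q ^ m) n * (q ^ y) ^ n =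
      q ^ (m * (n * (n - 1) / 2) + y * n) / qPochFinR (q ^ m) (q ^ m) n := by
  rw [eulerCoeff, Real.rpow_add hq0, Real.rpow_mul hq0.le, Real.rpow_mul hq0.le,
    ← Nat.cast_choose_two, Real.rpow_natCast, Real.rpow_natCast]
  ring

lemma JbarR_nonneg {q a m : ℝ} (hq0 : 0 < q) (hq1 : q < 1) (hm : 0 < m) : 0 ≤ JbarR q a m := by
  have h0 := Real.rpow_pos_of_pos hq0 m
  have h1 := Real.rpow_lt_one hq0.le hq1 hm
  have := qPochInfR_neg_nonneg h0 h1 (Real.rpow_pos_of_pos hq0 a)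
  have := qPochInfR_neg_nonneg h0 h1 (Real.rpow_pos_of_pos hq0 (m - a))
  have := qPochInfR_self_pos h0 h1
  rw [JbarR]
  positivity

/-- The Jacobi triple product identity. -/
lemma ofReal_JbarR {q a m : ℝ} (hq0 : 0 < q) (hq1 : q < 1) (hm : 0 < m) :
    ENNReal.ofReal (JbarR q a m) =
      ∑' n : ℤ, ENNReal.ofReal (q ^ (m * (n * (n - 1) / 2) + a * n)) := by
  have h0 := Real.rpow_pos_of_pos hq0 m
  have h1 := Real.rpow_lt_one hq0.le hq1 hm
  have ha := Real.rpow_pos_of_pos hq0 a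
  have hma := Real.rpow_pos_of_pos hq0 (m - a)
  have hW := qPochInfR_self_pos h0 h1
  have hn1 := qPochInfR_neg_nonneg h0 h1 ha
  have hn2 := qPochInfR_neg_nonneg h0 h1 hma
  have hfold := tsum_tsum_pow_mul_div_qPochFinR h0 h1
    fun n ↦ ENNReal.ofReal (q ^ (m * (n * (n - 1) / 2) + a * n))
  have hprod : ENNReal.ofReal (qPochInfR (-(q ^ a)) (q ^ m)) *
      ENNReal.ofReal (qPochInfR (-(q ^ (m - a))) (q ^ m)) =
      ENNReal.ofReal (1 / qPochInfR (q ^ m) (q ^ m)) *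
        ∑' n : ℤ, ENNReal.ofReal (q ^ (m * (n * (n - 1) / 2) + a * n)) := by
    rw [← hfold, ofReal_qPochInfR_neg h0 h1 ha, ofReal_qPochInfR_neg h0 h1 hma,
      ← ENNReal.tsum_mul_right]
    refine tsum_congr fun i ↦ ?_
    rw [← ENNReal.tsum_mul_left]
    refine tsum_congr fun j ↦ ?_
    have hi := qPochFinR_self_pos h0 h1 i
    have hj := qPochFinR_self_pos h0 h1 j
    rw [eulerCoeff_rpow_mul hq0, eulerCoeff_rpow_mul hq0, ← ENNReal.ofReal_mul (by positivity),
      ← ENNReal.ofReal_mul (by positivity), div_mul_div_comm, div_mul_eq_mul_div,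
      ← Real.rpow_add hq0, ← Real.rpow_mul_natCast hq0.le, ← Real.rpow_add hq0]
    congr 3
    push_cast
    ring
  rw [JbarR, ENNReal.ofReal_mul (by positivity), ENNReal.ofReal_mul hn1, hprod, mul_right_comm,
    ← ENNReal.ofReal_mul (by positivity), one_div_mul_cancel hW.ne', ENNReal.ofReal_one, one_mul]

/-- Euler's expansion of `(-q^{y-mk};q^m)_∞ / (q^m;q^m)_k`, with the first `k` factors of the
product expanded separately. -/
lemma tsum_euler_shift {q m : ℝ} (hq0 : 0 < q) (hq1 : q < 1) (hm : 0 < m) (y : ℝ) (k : ℕ) :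
    ∑' i : ℕ, ENNReal.ofReal (q ^ (m * (i * (i - 1) / 2) + y * i) /
        (qPochFinR (q ^ m) (q ^ m) i * qPochFinR (q ^ m) (q ^ m) k)) =
      ∑ x ∈ antidiagonal k, ∑' i : ℕ, ENNReal.ofReal
        (q ^ (m * (x.1 * (x.1 - 1) / 2) + y * x.1 +
            (m * (i * (i - 1) / 2) + (y + m * (x.1 + x.2)) * i)) /
          (qPochFinR (q ^ m) (q ^ m) x.1 * qPochFinR (q ^ m) (q ^ m) x.2 *
            qPochFinR (q ^ m) (q ^ m) i)) := by
  have h0 := Real.rpow_pos_of_pos hq0 m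
  have h1 := Real.rpow_lt_one hq0.le hq1 hm
  have hy := Real.rpow_pos_of_pos hq0 y
  have hyk := Real.rpow_pos_of_pos hq0 (y + m * k)
  have hP := qPochFinR_self_pos h0 h1
  have hE := eulerCoeff_pos h0 h1
  have hz : q ^ y * (q ^ m) ^ k = q ^ (y + m * k) := by
    rw [Real.rpow_add hq0, Real.rpow_mul_natCast hq0.le]
  have hdiv : qPochInfR (-(q ^ y)) (q ^ m) / qPochFinR (q ^ m) (q ^ m) k =
      (∑ x ∈ antidiagonal k, eulerCoeff (q ^ m) x.1 * (q ^ y) ^ x.1 /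
        qPochFinR (q ^ m) (q ^ m) x.2) * qPochInfR (-(q ^ (y + m * k))) (q ^ m) := by
    rw [← qPochFinR_div_eq_sum_antidiagonal h0 h1, ← tsum_eulerCoeff h0 h1 hy,
      ← tsum_eulerCoeff h0 h1 hyk, tsum_eulerCoeff_iterate h0 h1 hy k, hz]
    ring
  have hL : ∑' i : ℕ, ENNReal.ofReal (q ^ (m * (i * (i - 1) / 2) + y * i) /
        (qPochFinR (q ^ m) (q ^ m) i * qPochFinR (q ^ m) (q ^ m) k)) =
      ENNReal.ofReal (qPochInfR (-(q ^ y)) (q ^ m) / qPochFinR (q ^ m) (q ^ m) k) := by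
    rw [div_eq_mul_inv, ENNReal.ofReal_mul (qPochInfR_neg_nonneg h0 h1 hy),
      ofReal_qPochInfR_neg h0 h1 hy, ← ENNReal.tsum_mul_right]
    refine tsum_congr fun i ↦ ?_
    have := hE i
    rw [← ENNReal.ofReal_mul (by positivity), eulerCoeff_rpow_mul hq0, ← div_eq_mul_inv, div_div]
  rw [hL, hdiv, ENNReal.ofReal_mul, ENNReal.ofReal_sum_of_nonneg, sum_mul]
  · refine sum_congr rfl fun x hx ↦ ?_
    have := hE x.1
    have := hP x.1
    have := hP x.2
    rw [ofReal_qPochInfR_neg h0 h1 hyk, ← ENNReal.tsum_mul_left]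
    refine tsum_congr fun i ↦ ?_
    rw [← ENNReal.ofReal_mul (by positivity), eulerCoeff_rpow_mul hq0, eulerCoeff_rpow_mul hq0,
      div_div, div_mul_div_comm, ← Real.rpow_add hq0, ← mem_antidiagonal.1 hx, Nat.cast_add]
  · intro x _
    have := hE x.1
    have := hP x.2
    positivity
  · refine sum_nonneg fun x _ ↦ ?_
    have := hE x.1
    have := hP x.2
    positivity

/-- The triple sum as a theta series of the hexagonal lattice. -/
lemma tsum_triple_eq_tsum_hexagonal {q : ℝ} (hq0 : 0 < q) (hq1 : q < 1) (c : ℝ) :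
    ∑' (i : ℕ) (j : ℕ) (k : ℕ), ENNReal.ofReal
      (q ^ (2 * (i : ℝ) ^ 2 + 2 * (j : ℝ) ^ 2 + 2 * (k : ℝ) ^ 2 - 2 * (i : ℝ) * (k : ℝ)
          - 2 * (j : ℝ) * (k : ℝ) - c * (i : ℝ) + c * (j : ℝ)) /
        (qPochFinR (q ^ (4 : ℝ)) (q ^ (4 : ℝ)) i * qPochFinR (q ^ (4 : ℝ)) (q ^ (4 : ℝ)) j *
          qPochFinR (q ^ (4 : ℝ)) (q ^ (4 : ℝ)) k)) =
    ENNReal.ofReal (1 / JR q 4 ^ 2) * ∑' (d : ℤ) (t : ℤ),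
      ENNReal.ofReal (q ^ (2 * (d : ℝ) ^ 2 + 2 * (t : ℝ) ^ 2 + 2 * d * t - c * (d + t))) := by
  have h0 := Real.rpow_pos_of_pos hq0 4
  have h1 := Real.rpow_lt_one hq0.le hq1 (zero_lt_four' ℝ)
  have hP := qPochFinR_self_pos h0 h1
  have hW : 0 < JR q 4 := qPochInfR_self_pos h0 h1
  have hpow (i j : ℕ) : (q ^ (4 : ℝ)) ^ (i * j) = q ^ (4 * (i : ℝ) * j) := by
    rw [← Real.rpow_mul_natCast hq0.le, Nat.cast_mul, mul_assoc]
  let f (i j k : ℕ) : ℝ≥0∞ := ENNReal.ofReal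
    (q ^ (2 * (i : ℝ) ^ 2 + 2 * (j : ℝ) ^ 2 + 2 * (k : ℝ) ^ 2 - 2 * (i : ℝ) * (k : ℝ)
        - 2 * (j : ℝ) * (k : ℝ) - c * (i : ℝ) + c * (j : ℝ)) /
      (qPochFinR (q ^ (4 : ℝ)) (q ^ (4 : ℝ)) i * qPochFinR (q ^ (4 : ℝ)) (q ^ (4 : ℝ)) j *
        qPochFinR (q ^ (4 : ℝ)) (q ^ (4 : ℝ)) k))
  let F (a r i j : ℕ) : ℝ≥0∞ := ENNReal.ofReal
    (q ^ (2 * (a : ℝ) ^ 2 + 2 * r ^ 2 + 2 * a * r + 2 * i ^ 2 + 2 * j ^ 2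
        + 2 * (i - j) * (a + r) - c * (a + i - j)) /
      (qPochFinR (q ^ (4 : ℝ)) (q ^ (4 : ℝ)) a * qPochFinR (q ^ (4 : ℝ)) (q ^ (4 : ℝ)) r *
        (qPochFinR (q ^ (4 : ℝ)) (q ^ (4 : ℝ)) i * qPochFinR (q ^ (4 : ℝ)) (q ^ (4 : ℝ)) j)))
  let G (t : ℤ) (a r : ℕ) : ℝ≥0∞ := ENNReal.ofReal
    (q ^ (2 * ((a : ℝ) - r) ^ 2 + 2 * (t : ℝ) ^ 2 + 2 * (a - r) * t - c * (a - r + t)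
        + 4 * a * r) /
      (qPochFinR (q ^ (4 : ℝ)) (q ^ (4 : ℝ)) a * qPochFinR (q ^ (4 : ℝ)) (q ^ (4 : ℝ)) r))
  have expand (j k : ℕ) :
      ∑' i : ℕ, f i j k = ∑ x ∈ antidiagonal k, ∑' i : ℕ, F x.1 x.2 i j := by
    have hj := hP j
    have h := congrArg (ENNReal.ofReal (q ^ (2 * (j : ℝ) ^ 2 + 2 * (k : ℝ) ^ 2 -
      2 * j * k + c * j) / qPochFinR (q ^ (4 : ℝ)) (q ^ (4 : ℝ)) j) * ·)
      (tsum_euler_shift hq0 hq1 (zero_lt_four' ℝ) (2 - 2 * k - c) k)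
    simp only [mul_sum, ← ENNReal.tsum_mul_left] at h
    convert h using 1
    · refine tsum_congr fun i ↦ ?_
      simp only [f]
      rw [← ENNReal.ofReal_mul (by positivity), div_mul_div_comm, ← Real.rpow_add hq0]
      congr 2
      · ring_nf
      · ring
    · refine sum_congr rfl fun x hx ↦ tsum_congr fun i ↦ ?_
      simp only [F]
      rw [← ENNReal.ofReal_mul (by positivity), div_mul_div_comm, ← Real.rpow_add hq0,
        ← mem_antidiagonal.1 hx, Nat.cast_add]
      congr 2
      · ring_nf
      · ring
  have fold (a r : ℕ) : ∑' (i : ℕ) (j : ℕ), F a r i j =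
      ENNReal.ofReal (1 / JR q 4) * ∑' t : ℤ, G t a r := by
    have ha := hP a
    have hr := hP r
    have h := tsum_tsum_pow_mul_div_qPochFinR h0 h1 fun n ↦ ENNReal.ofReal
      (q ^ (2 * (a : ℝ) ^ 2 + 2 * r ^ 2 + 2 * a * r + 2 * (n : ℝ) ^ 2 + 2 * n * (a + r)
        - c * (a + n)) / (qPochFinR (q ^ (4 : ℝ)) (q ^ (4 : ℝ)) a *
            qPochFinR (q ^ (4 : ℝ)) (q ^ (4 : ℝ)) r))
    rw [← (Equiv.subRight (r : ℤ)).tsum_eq] at h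
    convert h using 1
    · refine tsum_congr fun i ↦ tsum_congr fun j ↦ ?_
      have hi := hP i
      have hj := hP j
      simp only [F]
      rw [← ENNReal.ofReal_mul (by positivity), div_mul_div_comm, hpow, ← Real.rpow_add hq0]
      congr 2
      · push_cast
        ring_nf
      · ring
    · refine congrArg _ (tsum_congr fun t ↦ ?_)
      simp only [G]
      congr 3
      simp only [Equiv.subRight_apply]
      push_cast
      ring
  calc ∑' (i : ℕ) (j : ℕ) (k : ℕ), f i j k
    _ = ∑' (j : ℕ) (k : ℕ) (i : ℕ), f i j k := by
        rw [ENNReal.tsum_comm]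
        exact tsum_congr fun j ↦ ENNReal.tsum_comm
    _ = ∑' (j : ℕ) (a : ℕ) (r : ℕ) (i : ℕ), F a r i j := by
        refine tsum_congr fun j ↦ ?_
        rw [tsum_congr (expand j)]
        exact tsum_sum_antidiagonal fun a r ↦ ∑' i, F a r i j
    _ = ∑' (a : ℕ) (r : ℕ) (i : ℕ) (j : ℕ), F a r i j := by
        rw [ENNReal.tsum_comm]
        refine tsum_congr fun a ↦ ?_
        rw [ENNReal.tsum_comm]
        exact tsum_congr fun r ↦ ENNReal.tsum_comm
    _ = ENNReal.ofReal (1 / JR q 4) * ∑' (a : ℕ) (r : ℕ) (t : ℤ), G t a r := by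
        simp only [fold, ENNReal.tsum_mul_left]
    _ = ENNReal.ofReal (1 / JR q 4) * ∑' (t : ℤ) (a : ℕ) (r : ℕ), G t a r := by
        rw [ENNReal.tsum_comm (α := ℤ)]
        exact congrArg _ (tsum_congr fun a ↦ ENNReal.tsum_comm)
    _ = ENNReal.ofReal (1 / JR q 4) * (ENNReal.ofReal (1 / JR q 4) * ∑' (t : ℤ) (d : ℤ),
          ENNReal.ofReal
            (q ^ (2 * (d : ℝ) ^ 2 + 2 * (t : ℝ) ^ 2 + 2 * d * t - c * (d + t)))) := by
        congr 1
        rw [← ENNReal.tsum_mul_left]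
        refine tsum_congr fun t ↦ ?_
        refine Eq.trans ?_ (tsum_tsum_pow_mul_div_qPochFinR h0 h1 _)
        refine tsum_congr fun a ↦ tsum_congr fun r ↦ ?_
        have ha := hP a
        have hr := hP r
        simp only [G]
        rw [← ENNReal.ofReal_mul (by positivity), div_mul_eq_mul_div, hpow, ← Real.rpow_add hq0]
        congr 3
        push_cast
        ring
    _ = _ := by
        rw [← mul_assoc, ← ENNReal.ofReal_mul (by positivity), ENNReal.tsum_comm]
        congr 2
        ring

lemma tsum_int_eq_even_add_odd (f : ℤ → ℝ≥0∞) :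
    ∑' t, f t = ∑' b, f (-2 * b) + ∑' b, f (1 - 2 * b) := by
  rw [← (Int.divModEquiv 2).symm.tsum_eq, ENNReal.tsum_prod', ← (Equiv.neg ℤ).tsum_eq,
    ← ENNReal.tsum_add]
  refine tsum_congr fun b ↦ ?_
  rw [tsum_fintype, Fin.sum_univ_two]
  congr 2
  · simp [Int.divModEquiv, mul_comm]
  · simp [Int.divModEquiv]
    ring

lemma tsum_hexagonal_eq_JbarR {q : ℝ} (hq0 : 0 < q) (hq1 : q < 1) (c : ℝ) :
    ∑' (d : ℤ) (t : ℤ),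
      ENNReal.ofReal (q ^ (2 * (d : ℝ) ^ 2 + 2 * (t : ℝ) ^ 2 + 2 * d * t - c * (d + t))) =
    ENNReal.ofReal (JbarR q (2 + c) 4 * JbarR q (6 + c) 12 +
      q ^ 2 * JbarR q (-c) 4 * JbarR q c 12) := by
  have hJ4 (a : ℝ) := JbarR_nonneg (a := a) hq0 hq1 (zero_lt_four' ℝ)
  have hJ12 (a : ℝ) := JbarR_nonneg (a := a) hq0 hq1 (by norm_num : (0 : ℝ) < 12)
  have hj1 := hJ4 (2 + c)
  have hj2 := hJ4 (-c)
  have hj3 := hJ12 (6 + c)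
  have hj4 := hJ12 c
  have hq2 : q ^ 2 = q ^ (2 : ℝ) := (Real.rpow_two q).symm
  rw [ENNReal.ofReal_add (by positivity) (by positivity), ENNReal.ofReal_mul hj1,
    ENNReal.ofReal_mul (by positivity), ENNReal.ofReal_mul (by positivity), hq2,
    ofReal_JbarR hq0 hq1 (zero_lt_four' ℝ), ofReal_JbarR hq0 hq1 (by norm_num : (0 : ℝ) < 12),
    ofReal_JbarR hq0 hq1 (zero_lt_four' ℝ), ofReal_JbarR hq0 hq1 (by norm_num : (0 : ℝ) < 12),
    ENNReal.tsum_comm, tsum_int_eq_even_add_odd]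
  congr 1
  · rw [← ENNReal.tsum_mul_left]
    refine tsum_congr fun b ↦ ?_
    rw [← ENNReal.tsum_mul_right, ← (Equiv.subLeft b).tsum_eq]
    refine tsum_congr fun a ↦ ?_
    rw [← ENNReal.ofReal_mul (by positivity), ← Real.rpow_add hq0]
    congr 2
    simp only [Equiv.subLeft_apply]
    push_cast
    ring
  · rw [← ENNReal.tsum_mul_left]
    refine tsum_congr fun b ↦ ?_
    rw [mul_assoc, ← ENNReal.tsum_mul_right, ← ENNReal.tsum_mul_left,
      ← (Equiv.addRight (b - 1)).tsum_eq]
    refine tsum_congr fun a ↦ ?_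
    rw [← ENNReal.ofReal_mul (by positivity), ← ENNReal.ofReal_mul (by positivity),
      ← Real.rpow_add hq0, ← Real.rpow_add hq0]
    congr 2
    simp only [Equiv.coe_addRight]
    push_cast
    ring

lemma tsum_tsum_tsum_toReal {α β γ : Type*} {f : α → β → γ → ℝ} (hf : ∀ i j k, 0 ≤ f i j k)
    (h : ∑' (i) (j) (k), ENNReal.ofReal (f i j k) ≠ ∞) :
    ∑' (i) (j) (k), f i j k = (∑' (i) (j) (k), ENNReal.ofReal (f i j k)).toReal := by
  have h1 := ENNReal.ne_top_of_tsum_ne_top h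
  rw [ENNReal.tsum_toReal_eq h1]
  refine tsum_congr fun i ↦ ?_
  have h2 := ENNReal.ne_top_of_tsum_ne_top (h1 i)
  rw [ENNReal.tsum_toReal_eq h2]
  refine tsum_congr fun j ↦ ?_
  rw [ENNReal.tsum_toReal_eq fun _ ↦ ENNReal.ofReal_ne_top]
  exact tsum_congr fun k ↦ (ENNReal.toReal_ofReal (hf i j k)).symm

theorem stmt15 (q : ℝ) (hq0 : 0 < q) (hq1 : q < 1) (c : ℝ) :
    (∑' (i : ℕ) (j : ℕ) (k : ℕ),
      q ^ (2*(i:ℝ)^2 + 2*(j:ℝ)^2 + 2*(k:ℝ)^2 - 2*(i:ℝ)*(k:ℝ) - 2*(j:ℝ)*(k:ℝ)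
            - c*(i:ℝ) + c*(j:ℝ)) /
        (qPochFinR (q ^ (4:ℕ)) (q ^ (4:ℕ)) i * qPochFinR (q ^ (4:ℕ)) (q ^ (4:ℕ)) j *
          qPochFinR (q ^ (4:ℕ)) (q ^ (4:ℕ)) k)) =
    JbarR q (2+c) 4 * JbarR q (6+c) 12 / JR q 4 ^ 2
    + q ^ (2:ℕ) * JbarR q (-c) 4 * JbarR q c 12 / JR q 4 ^ 2 := by
  have h4 : q ^ (4 : ℕ) = q ^ (4 : ℝ) := by exact_mod_cast (Real.rpow_natCast q 4).symm
  have h0 := Real.rpow_pos_of_pos hq0 4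
  have h1 := Real.rpow_lt_one hq0.le hq1 (zero_lt_four' ℝ)
  have hJ4 (a : ℝ) := JbarR_nonneg (a := a) hq0 hq1 (zero_lt_four' ℝ)
  have hJ12 (a : ℝ) := JbarR_nonneg (a := a) hq0 hq1 (by norm_num : (0 : ℝ) < 12)
  have hj1 := hJ4 (2 + c)
  have hj2 := hJ4 (-c)
  have hj3 := hJ12 (6 + c)
  have hj4 := hJ12 c
  have hsum := tsum_triple_eq_tsum_hexagonal hq0 hq1 c
  rw [tsum_hexagonal_eq_JbarR hq0 hq1, ← ENNReal.ofReal_mul (by positivity)] at hsum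
  rw [h4, tsum_tsum_tsum_toReal, hsum, ENNReal.toReal_ofReal (by positivity)]
  · ring
  · intro i j k
    have := qPochFinR_self_pos h0 h1 i
    have := qPochFinR_self_pos h0 h1 j
    have := qPochFinR_self_pos h0 h1 k
    positivity
  · rw [hsum]
    exact ENNReal.ofReal_ne_top
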